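/- Let G=(V,E) be a finite simple graph with |V| ≥ 4 and suppose that every generic realization of G in ℝ² is globally rigid. Then G is redundantly rigid in ℝ², that is, G−e is rigid in ℝ² for every edge e ∈ E. -/

import Mathlib

open scoped BigOperators

noncomputable section

namespace Rigidity

variable {V : Type*}

/-- Euclidean distance between two points of `ℝ^d` (given as coordinate functions). -/
def eDist {d : ℕ} (x y : Fin d → ℝ) : ℝ := Real.sqrt (∑ i, (x i - y i) ^ 2)

/-- Two frameworks `(G,p)` and `(G,q)` are equivalent if corresponding edge lengths agree. -/
def Equivalent {d : ℕ} (G : SimpleGraph V) (p q : V → Fin d → ℝ) : Prop :=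
  ∀ u v : V, G.Adj u v → eDist (p u) (p v) = eDist (q u) (q v)

/-- Two placements are congruent if all pairwise distances agree. -/
def Congruent {d : ℕ} (p q : V → Fin d → ℝ) : Prop :=
  ∀ u v : V, eDist (p u) (p v) = eDist (q u) (q v)

/-- A placement is generic if the multiset of its coordinates is algebraically
independent over `ℚ`. -/
def Generic {d : ℕ} (p : V → Fin d → ℝ) : Prop :=
  AlgebraicIndependent ℚ (fun vi : V × Fin d => p vi.1 vi.2)

/-- `{u,v}` is globally linked in the framework `(G,p)`. -/
def GloballyLinkedIn {d : ℕ} (G : SimpleGraph V) (p : V → Fin d → ℝ) (u v : V) : Prop :=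
  ∀ q : V → Fin d → ℝ, Equivalent G p q → eDist (q u) (q v) = eDist (p u) (p v)

/-- `{u,v}` is globally `d`-linked in `G`. -/
def GloballyLinked (d : ℕ) (G : SimpleGraph V) (u v : V) : Prop :=
  ∀ p : V → Fin d → ℝ, Generic p → GloballyLinkedIn G p u v

/-- The framework `(G,p)` is rigid. -/
def RigidFramework {d : ℕ} (G : SimpleGraph V) (p : V → Fin d → ℝ) : Prop :=
  ∃ ε > (0:ℝ), ∀ q : V → Fin d → ℝ, Equivalent G p q →
    (∀ v, eDist (p v) (q v) < ε) → Congruent p q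

/-- `G` is `d`-rigid: every generic framework of `G` in `ℝ^d` is rigid. -/
def IsRigidGraph (d : ℕ) (G : SimpleGraph V) : Prop :=
  ∀ p : V → Fin d → ℝ, Generic p → RigidFramework G p

/-- The framework `(G,p)` is globally rigid. -/
def GloballyRigidFramework {d : ℕ} (G : SimpleGraph V) (p : V → Fin d → ℝ) : Prop :=
  ∀ q : V → Fin d → ℝ, Equivalent G p q → Congruent p q

/-- The row of the rigidity matrix corresponding to the (ordered) edge `(u,v)`. -/
def edgeVec [DecidableEq V] {d : ℕ} (p : V → Fin d → ℝ) (u v : V) : V × Fin d → ℝ :=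
  fun wi => if wi.1 = u then p u wi.2 - p v wi.2
            else if wi.1 = v then p v wi.2 - p u wi.2 else 0

/-- The rank of the set of rows of the rigidity matrix of `(·,p)` indexed by `F`. -/
def rankAt [DecidableEq V] (d : ℕ) (p : V → Fin d → ℝ) (F : Set (Sym2 V)) : ℕ :=
  Module.finrank ℝ (Submodule.span ℝ
    {x : V × Fin d → ℝ | ∃ u v : V, s(u, v) ∈ F ∧ x = edgeVec p u v})

/-- `r_d(F)`: the rank of the set of rows indexed by `F` of the rigidity matrix of a
generic framework, equivalently the maximum of this rank over all placements. -/
def rd [DecidableEq V] (d : ℕ) (F : Set (Sym2 V)) : ℕ :=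
  sSup {n : ℕ | ∃ p : V → Fin d → ℝ, n = rankAt d p F}

/-- An edge set is `ℛ_d`-independent if its rank equals its cardinality. -/
def RdIndep [DecidableEq V] (d : ℕ) (F : Set (Sym2 V)) : Prop := rd d F = F.ncard

/-- An `ℛ_d`-circuit: not independent, but every proper subset is independent. -/
def RdCircuit [DecidableEq V] (d : ℕ) (C : Set (Sym2 V)) : Prop :=
  ¬ RdIndep d C ∧ ∀ C' : Set (Sym2 V), C' ⊂ C → RdIndep d C'

/-- An `ℛ_d`-circuit of the graph `G`. -/
def RdCircuitOf [DecidableEq V] (d : ℕ) (G : SimpleGraph V) (C : Set (Sym2 V)) : Prop :=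
  C ⊆ G.edgeSet ∧ RdCircuit d C

/-- `F` is (the edge set of) an `ℛ_d`-component of `G`: an equivalence class of the
relation "`e = f` or some `ℛ_d`-circuit of `G` contains both `e` and `f`". -/
def IsRdComponent [DecidableEq V] (d : ℕ) (G : SimpleGraph V) (F : Set (Sym2 V)) : Prop :=
  ∃ e ∈ G.edgeSet, F = {f | f ∈ G.edgeSet ∧
    (e = f ∨ ∃ C, RdCircuitOf d G C ∧ e ∈ C ∧ f ∈ C)}

/-- The set of vertices covered by an edge set. -/
def vertexSpan (F : Set (Sym2 V)) : Set V := {v | ∃ e ∈ F, v ∈ e}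

/-- A nonempty edge set is `ℛ_d`-connected if any two of its edges lie on a common
`ℛ_d`-circuit contained in it (or are equal). -/
def RdConnectedSet [DecidableEq V] (d : ℕ) (F : Set (Sym2 V)) : Prop :=
  F.Nonempty ∧ ∀ e ∈ F, ∀ f ∈ F, e = f ∨ ∃ C, C ⊆ F ∧ RdCircuit d C ∧ e ∈ C ∧ f ∈ C

/-- A graph (with at least one edge) is `ℛ_d`-connected. -/
def RdConnected [DecidableEq V] (d : ℕ) (H : SimpleGraph V) : Prop :=
  RdConnectedSet d H.edgeSet

/-- `e` is an `ℛ_d`-bridge of `G`: `r_d(E ∖ {e}) = r_d(E) − 1`. -/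
def IsRdBridge [DecidableEq V] (d : ℕ) (G : SimpleGraph V) (e : Sym2 V) : Prop :=
  e ∈ G.edgeSet ∧ rd d (G.edgeSet \ {e}) + 1 = rd d G.edgeSet

/-- `G + uv`. -/
def addEdge (G : SimpleGraph V) (u v : V) : SimpleGraph V :=
  G ⊔ SimpleGraph.fromEdgeSet {s(u, v)}

/-- `{u,v}` is `d`-linked in `G` if `r_d(G+uv) = r_d(G)`. -/
def IsLinked [DecidableEq V] (d : ℕ) (G : SimpleGraph V) (u v : V) : Prop :=
  rd d (addEdge G u v).edgeSet = rd d G.edgeSet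

/-- There exist `k` pairwise internally vertex-disjoint `u`–`v` paths in `H`
(i.e. `κ_H(u,v) ≥ k`). -/
def InternallyDisjointPaths (H : SimpleGraph V) (u v : V) (k : ℕ) : Prop :=
  ∃ P : Fin k → H.Walk u v, (∀ i, (P i).IsPath) ∧
    ∀ i j, i ≠ j → ∀ w, w ∈ (P i).support → w ∈ (P j).support → w = u ∨ w = v

/-- An unordered pair forming a 2-separator: two distinct vertices whose deletion
disconnects the graph. -/
def TwoSepPair (H : SimpleGraph V) (e : Sym2 V) : Prop :=
  ¬ e.IsDiag ∧ ¬ (H.induce {v | v ∉ e}).Connected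

/-- The augmented graph `Ĥ`: add an edge for every 2-separator. -/
def aug (H : SimpleGraph V) : SimpleGraph V :=
  H ⊔ SimpleGraph.fromEdgeSet {e | TwoSepPair H e}

/-- A subgraph is 3-connected: at least 4 vertices, and deleting fewer than 3
vertices leaves it connected. -/
def IsThreeConnectedSubgraph {G : SimpleGraph V} (J : G.Subgraph) : Prop :=
  4 ≤ J.verts.ncard ∧ ∀ S : Set V, S.ncard < 3 → (J.deleteVerts S).coe.Connected

/-- A 3-block of `H`: a maximal 3-connected subgraph of the augmented graph `Ĥ`. -/
def IsThreeBlock (H : SimpleGraph V) (J : (aug H).Subgraph) : Prop :=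
  IsThreeConnectedSubgraph J ∧
    ∀ J' : (aug H).Subgraph, IsThreeConnectedSubgraph J' → J ≤ J' → J = J'

/-- `h_H(e)`: the number of 3-blocks of `H` containing both vertices of `e`. -/
def numBlocksOn (H : SimpleGraph V) (e : Sym2 V) : ℕ :=
  {J : (aug H).Subgraph | IsThreeBlock H J ∧ ∀ v ∈ e, v ∈ J.verts}.ncard

open Classical in
/-- `k(H) = Σ (h_H(ab) − 1)` over all 2-separators `{a,b}` of `H`. -/
def kGraph [Fintype V] [DecidableEq V] (H : SimpleGraph V) : ℕ :=
  ∑ e : Sym2 V, if TwoSepPair H e then numBlocksOn H e - 1 else 0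

/-- The graph of an `ℛ₂`-component, on its own vertex set. -/
def componentGraph [DecidableEq V] (F : Set (Sym2 V)) :
    SimpleGraph (vertexSpan F) :=
  (SimpleGraph.fromEdgeSet F).induce (vertexSpan F)

/-- `X` is the vertex set of an `ℛ_d`-block of `G`: a 3-block of a non-trivial
`ℛ_d`-component of `G`. -/
def IsRdBlockVerts [DecidableEq V] (d : ℕ) (G : SimpleGraph V) (X : Set V) : Prop :=
  ∃ F : Set (Sym2 V), IsRdComponent d G F ∧ 2 ≤ F.ncard ∧
    ∃ J : (aug (componentGraph F)).Subgraph,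
      IsThreeBlock (componentGraph F) J ∧ X = Subtype.val '' J.verts

/-- The globally linked closure of `G` in `ℝ^d`. -/
def glc (d : ℕ) (G : SimpleGraph V) : SimpleGraph V :=
  G ⊔ SimpleGraph.fromEdgeSet {e | ∃ u v : V, e = s(u, v) ∧ GloballyLinked d G u v}

/-- A globally `d`-linked cluster: the vertex set of a maximal complete subgraph of
`glc_d(G)`. -/
def IsCluster (d : ℕ) (G : SimpleGraph V) (X : Set V) : Prop :=
  (∀ a ∈ X, ∀ b ∈ X, a ≠ b → (glc d G).Adj a b) ∧
    ∀ Y : Set V, X ⊆ Y → (∀ a ∈ Y, ∀ b ∈ Y, a ≠ b → (glc d G).Adj a b) → Y = X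

/-- Equilibrium stress of a framework, encoded as a symmetric function vanishing on
non-edges. -/
def IsEqStress [Fintype V] {d : ℕ} (G : SimpleGraph V) (p : V → Fin d → ℝ)
    (ω : V → V → ℝ) : Prop :=
  (∀ u v, ω u v = ω v u) ∧ (∀ u v, ¬ G.Adj u v → ω u v = 0) ∧
    ∀ u, ∑ v, ω u v • (p u - p v) = 0

/-- `{u,v}` is `d`-stress-linked in `G`. -/
def StressLinked [Fintype V] (d : ℕ) (G : SimpleGraph V) (u v : V) : Prop :=
  ∀ p : V → Fin d → ℝ, Generic p → ∀ q : V → Fin d → ℝ,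
    (∀ ω, IsEqStress G p ω → IsEqStress G q ω) →
    ∀ ω, IsEqStress (addEdge G u v) p ω → IsEqStress (addEdge G u v) q ω

/-- Equivalence of complex frameworks. -/
def CEquivalent {d : ℕ} (G : SimpleGraph V) (p q : V → Fin d → ℂ) : Prop :=
  ∀ u v : V, G.Adj u v →
    ∑ i, (p u i - p v i) ^ 2 = ∑ i, (q u i - q v i) ^ 2

/-- Generic complex placement. -/
def CGeneric {d : ℕ} (p : V → Fin d → ℂ) : Prop :=
  AlgebraicIndependent ℚ (fun vi : V × Fin d => p vi.1 vi.2)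

/-- `{u,v}` is globally linked in `G` in `ℂ^d`. -/
def CGloballyLinked (d : ℕ) (G : SimpleGraph V) (u v : V) : Prop :=
  ∀ p : V → Fin d → ℂ, CGeneric p → ∀ q : V → Fin d → ℂ, CEquivalent G p q →
    ∑ i, (q u i - q v i) ^ 2 = ∑ i, (p u i - p v i) ^ 2

/-- A flexing of the framework `(G,q)`. -/
def IsFlexing {d : ℕ} (G : SimpleGraph V) (q : V → Fin d → ℝ)
    (φ : Set.Icc (0:ℝ) 1 → V → Fin d → ℝ) : Prop :=
  Continuous φ ∧ φ ⟨0, Set.left_mem_Icc.mpr zero_le_one⟩ = q ∧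
    (∀ t, Equivalent G q (φ t)) ∧
    ∀ t : Set.Icc (0:ℝ) 1, 0 < (t : ℝ) → ¬ Congruent q (φ t)

/-- A finite loopless multigraph on vertex type `V` with edge type `E`. -/
structure Multigraph (V : Type*) (E : Type*) where
  ends : E → Sym2 V
  loopless : ∀ e, ¬ (ends e).IsDiag

/-- The data `(B, bar)` exhibits `G` as a body-bar graph induced by `H`. -/
def IsBodyBar {V E W : Type*} (H : Multigraph V E) (G : SimpleGraph W)
    (B : V → Set W) (bar : E → W × W) : Prop :=
  (∀ w : W, ∃! v : V, w ∈ B v) ∧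
  (∀ v : V, (B v).ncard = {e : E | v ∈ H.ends e}.ncard) ∧
  (∀ e : E, ∃ w z : V, H.ends e = s(w, z) ∧ (bar e).1 ∈ B w ∧ (bar e).2 ∈ B z) ∧
  (∀ e : E, (bar e).1 ≠ (bar e).2) ∧
  (∀ e e' : E, e ≠ e' →
    ({(bar e).1, (bar e).2} ∩ {(bar e').1, (bar e').2} : Set W) = ∅) ∧
  (∀ a b : W, G.Adj a b ↔ a ≠ b ∧
    ((∃ v : V, a ∈ B v ∧ b ∈ B v) ∨ ∃ e : E, s(a, b) = s((bar e).1, (bar e).2)))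

/-- `P` is a partition of the set `X`. -/
def IsPartitionOf {V : Type*} (X : Set V) (P : Set (Set V)) : Prop :=
  (∀ p ∈ P, p.Nonempty ∧ p ⊆ X) ∧ ∀ v ∈ X, ∃! p, p ∈ P ∧ v ∈ p

/-- The subgraph `(X,F)` of the multigraph `H` is `k`-tree-connected. -/
def SubTreeConnected {V E : Type*} (k : ℕ) (H : Multigraph V E)
    (X : Set V) (F : Set E) : Prop :=
  X.Nonempty ∧ (∀ e ∈ F, ∀ v ∈ H.ends e, v ∈ X) ∧
    ∀ P : Set (Set V), IsPartitionOf X P →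
      k * (P.ncard - 1) ≤ {e | e ∈ F ∧ ¬ ∃ p ∈ P, ∀ v ∈ H.ends e, v ∈ p}.ncard

/-- `(X,F)` is a `k`-superbrick of `H`: a maximal `k`-tree-connected subgraph. -/
def IsSuperbrick {V E : Type*} (k : ℕ) (H : Multigraph V E)
    (X : Set V) (F : Set E) : Prop :=
  SubTreeConnected k H X F ∧
    ∀ X' F', SubTreeConnected k H X' F' → X ⊆ X' → F ⊆ F' → X = X' ∧ F = F'

open MvPolynomial in
theorem derivation_aeval {ι : Type*} [Fintype ι] (D : Derivation ℚ ℝ ℝ) (x : ι → ℝ)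
    (p : MvPolynomial ι ℚ) :
    D (aeval x p) = ∑ i, aeval x (pderiv i p) * D (x i) := by
  classical
  induction p using MvPolynomial.induction_on with
  | C a => simpa using D.map_algebraMap a
  | add p q hp hq => simp [hp, hq, add_mul, Finset.sum_add_distrib]
  | mul_X p i hp =>
    simp only [map_mul, aeval_X, Derivation.leibniz, smul_eq_mul, pderiv_X, map_add, hp, add_mul,
      Finset.sum_add_distrib]
    congr 1
    · rw [Finset.sum_eq_single i]
      · simp
      · intro j _ hj
        simp [hj.symm]
      · simp
    · rw [Finset.mul_sum]
      exact Finset.sum_congr rfl fun j _ => by ring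

theorem exists_derivation_extension (S : Type*) [CommRing S] [Algebra ℚ S] [Algebra S ℝ]
    [IsScalarTower ℚ S ℝ] [Algebra.FormallyEtale S ℝ] (d : Derivation ℚ S ℝ) :
    ∃ D : Derivation ℚ ℝ ℝ, ∀ s, D (algebraMap S ℝ s) = d s := by
  let e := KaehlerDifferential.tensorKaehlerEquivOfFormallyEtale ℚ S ℝ
  let f : TensorProduct S ℝ (Ω[S⁄ℚ]) →ₗ[ℝ] ℝ :=
    d.liftKaehlerDifferential.liftBaseChange ℝ
  refine ⟨(f ∘ₗ e.symm.toLinearMap).compDer (KaehlerDifferential.D ℚ ℝ), fun s => ?_⟩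
  have := KaehlerDifferential.tensorKaehlerEquivOfFormallyEtale_symm_D_algebraMap ℚ S ℝ s
  simp [e, f, this]

theorem formallyEtale_of_isTranscendenceBasis {s : Set ℝ}
    (hs : IsTranscendenceBasis ℚ ((↑) : s → ℝ)) :
    let := (MvPolynomial.aeval ((↑) : s → ℝ) : MvPolynomial s ℚ →ₐ[ℚ] ℝ).toRingHom.toAlgebra
    Algebra.FormallyEtale (MvPolynomial s ℚ) ℝ := by
  let := (MvPolynomial.aeval ((↑) : s → ℝ) : MvPolynomial s ℚ →ₐ[ℚ] ℝ).toRingHom.toAlgebra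
  have hinj : Function.Injective (algebraMap (MvPolynomial s ℚ) ℝ) := hs.1
  have : FaithfulSMul (MvPolynomial s ℚ) ℝ := (faithfulSMul_iff_algebraMap_injective _ _).2 hinj
  let : Algebra (FractionRing (MvPolynomial s ℚ)) ℝ := FractionRing.liftAlgebra _ _
  have : IsScalarTower (MvPolynomial s ℚ) (FractionRing (MvPolynomial s ℚ)) ℝ :=
    FractionRing.isScalarTower_liftAlgebra _ _
  have : Algebra.IsAlgebraic (MvPolynomial s ℚ) ℝ := by
    have := hs.isAlgebraic
    constructor
    intro x
    obtain ⟨p, hp, hx⟩ := this.isAlgebraic x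
    let e := hs.1.aevalEquiv
    refine ⟨p.map e.symm.toRingEquiv.toRingHom, ?_, ?_⟩
    · rwa [Ne, Polynomial.map_eq_zero_iff e.symm.injective]
    · rw [Polynomial.aeval_def, Polynomial.eval₂_map, ← hx, Polynomial.aeval_def]
      congr 1
      ext y
      obtain ⟨y, rfl⟩ := e.surjective y
      simp [e, RingHom.algebraMap_toAlgebra]
  have : Algebra.IsAlgebraic (FractionRing (MvPolynomial s ℚ)) ℝ :=
    .extendScalars (R := MvPolynomial s ℚ) (IsFractionRing.injective _ _)
  have : Algebra.FormallyEtale (FractionRing (MvPolynomial s ℚ)) ℝ :=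
    Algebra.FormallyEtale.of_isSeparable _ _
  have : Algebra.FormallyEtale (MvPolynomial s ℚ) (FractionRing (MvPolynomial s ℚ)) :=
    .of_isLocalization (nonZeroDivisors _)
  exact .comp _ (FractionRing (MvPolynomial s ℚ)) _

/-- Derivations of `ℝ` can be prescribed arbitrarily on algebraically independent elements. -/
theorem exists_derivation_of_algebraicIndependent {J : Type*} {a : J → ℝ}
    (ha : AlgebraicIndependent ℚ a) (w : J → ℝ) :
    ∃ D : Derivation ℚ ℝ ℝ, ∀ j, D (a j) = w j := by
  obtain ⟨s, has, hs⟩ := exists_isTranscendenceBasis_superset (s := Set.range a) ha.to_subtype_range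
  let := (MvPolynomial.aeval ((↑) : s → ℝ) : MvPolynomial s ℚ →ₐ[ℚ] ℝ).toRingHom.toAlgebra
  have := formallyEtale_of_isTranscendenceBasis hs
  have : IsScalarTower ℚ (MvPolynomial s ℚ) ℝ := .of_algebraMap_eq' (Subsingleton.elim _ _)
  obtain ⟨D, hD⟩ := exists_derivation_extension (MvPolynomial s ℚ)
    (MvPolynomial.mkDerivation ℚ fun y : s => Function.extend a w 0 y)
  refine ⟨D, fun j => ?_⟩
  have := hD (MvPolynomial.X ⟨a j, has ⟨j, rfl⟩⟩)
  rw [MvPolynomial.mkDerivation_X, ha.injective.extend_apply] at this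
  rw [← this]
  simp [RingHom.algebraMap_toAlgebra]

theorem transcendental_of_derivation_ne_zero {A : Subalgebra ℚ ℝ} {y : ℝ}
    (D : Derivation ℚ ℝ ℝ) (hA : ∀ a ∈ A, D a = 0) (hy : D y ≠ 0) : Transcendental A y := by
  have key : ∀ p : Polynomial A,
      D (Polynomial.aeval y p) = Polynomial.aeval y (Polynomial.derivative p) * D y := by
    intro p
    induction p using Polynomial.induction_on' with
    | add p q hp hq => simp [hp, hq, add_mul]
    | monomial n a =>
      have : D (a : ℝ) = 0 := hA a a.2
      simp [Polynomial.aeval_monomial, this, Polynomial.derivative_monomial, Derivation.leibniz_pow,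
        Algebra.algebraMap_eq_smul_one, Subalgebra.smul_def]
      ring
  rw [transcendental_iff]
  intro p hp
  induction hn : p.natDegree using Nat.strong_induction_on generalizing p with
  | _ n ih =>
    have hd : Polynomial.aeval y (Polynomial.derivative p) = 0 := by
      have := key p
      rw [hp, map_zero, eq_comm, mul_eq_zero] at this
      exact this.resolve_right hy
    have hd0 : Polynomial.derivative p = 0 := by
      by_cases h0 : p.natDegree = 0
      · exact Polynomial.derivative_of_natDegree_zero h0
      · exact ih _ (hn ▸ Polynomial.natDegree_derivative_lt h0) _ hd rfl
    have := Polynomial.derivative_eq_zero.1 hd0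
    rw [Polynomial.eq_C_of_natDegree_eq_zero this] at hp ⊢
    simpa using hp

/-- The values at `x` of a family of rational polynomials. -/
def polyVal {ι K : Type*} (P : K → MvPolynomial ι ℚ) (x : ι → ℝ) (k : K) : ℝ :=
  MvPolynomial.aeval x (P k)

/-- The rows of the Jacobian matrix at `x` of a family of rational polynomials. -/
def jacRow {ι K : Type*} (P : K → MvPolynomial ι ℚ) (x : ι → ℝ) (k : K) : ι → ℝ :=
  fun i => MvPolynomial.aeval x (MvPolynomial.pderiv i (P k))

section Algebra

variable {ι K : Type*} [Fintype ι] {P : K → MvPolynomial ι ℚ}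

theorem derivation_polyVal (D : Derivation ℚ ℝ ℝ) (x : ι → ℝ) (k : K) :
    D (polyVal P x k) = jacRow P x k ⬝ᵥ (fun i => D (x i)) :=
  derivation_aeval D x (P k)

theorem linearIndepOn_jacRow {x : ι → ℝ} {S : Set K}
    (h : AlgebraicIndepOn ℚ (polyVal P x) S) : LinearIndepOn ℝ (jacRow P x) S := by
  classical
  rw [LinearIndepOn, linearIndependent_iff']
  intro t g hg j hj
  obtain ⟨D, hD⟩ := exists_derivation_of_algebraicIndependent h (Pi.single j 1)
  have h1 : (∑ i ∈ t, g i • jacRow P x i) ⬝ᵥ (fun i => D (x i)) = 0 := by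
    rw [hg, zero_dotProduct]
  simp only [sum_dotProduct, smul_dotProduct, ← derivation_polyVal, smul_eq_mul] at h1
  simp only [hD] at h1
  simpa [Pi.single_apply, hj] using h1

theorem exists_dual_vector {r : K → ι → ℝ} {S : Set K} (h : LinearIndepOn ℝ r S)
    (w : S → ℝ) : ∃ v : ι → ℝ, ∀ j : S, r j ⬝ᵥ v = w j := by
  classical
  let b := Module.Basis.span (v := fun j : S => r j) h
  obtain ⟨f, hf⟩ := LinearMap.exists_extend (b.constr ℝ w)
  refine ⟨fun i => f fun j => if i = j then 1 else 0, fun j => ?_⟩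
  have h1 : f (r j) = w j := by
    have h2 := b.constr_basis ℝ w j
    rw [← hf, LinearMap.comp_apply, Submodule.subtype_apply] at h2
    rwa [show (b j : ι → ℝ) = r j from congrArg Subtype.val (Module.Basis.span_apply h j)] at h2
  rw [← h1, f.pi_apply_eq_sum_univ (r j)]
  simp [dotProduct]

theorem algebraicIndepOn_polyVal {x : ι → ℝ} (hx : AlgebraicIndependent ℚ x) {S : Set K}
    (h : LinearIndepOn ℝ (jacRow P x) S) : AlgebraicIndepOn ℚ (polyVal P x) S := by
  classical
  have key : ∀ j : S, ∃ D : Derivation ℚ ℝ ℝ,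
      ∀ i : S, D (polyVal P x i) = Pi.single (M := fun _ => ℝ) j 1 i := by
    intro j
    obtain ⟨v, hv⟩ := exists_dual_vector h (Pi.single j 1)
    obtain ⟨D, hD⟩ := exists_derivation_of_algebraicIndependent hx v
    refine ⟨D, fun i => ?_⟩
    rw [derivation_polyVal, ← hv]
    simp [hD]
  refine algebraicIndependent_of_finite_type' (algebraMap ℚ ℝ).injective ?_
  intro t _ _ j hj
  obtain ⟨D, hD⟩ := key j
  refine transcendental_of_derivation_ne_zero D (fun a ha => ?_) (by simp [hD])
  induction ha using Algebra.adjoin_induction with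
  | mem a ha =>
    obtain ⟨i, hi, rfl⟩ := ha
    rw [hD, Pi.single_apply, if_neg]
    rintro rfl
    exact hj hi
  | algebraMap r => exact D.map_algebraMap r
  | add a b _ _ ha hb => simp [ha, hb]
  | mul a b _ _ ha hb => simp [ha, hb]

theorem aeval_option_elim {σ : Type*} (a : σ → ℝ) (c : ℝ) (R : MvPolynomial (Option σ) ℚ) :
    MvPolynomial.aeval (fun o : Option σ => o.elim c a) R =
      ((MvPolynomial.optionEquivLeft ℚ σ R).map (MvPolynomial.aeval a).toRingHom).eval c := by
  induction R using MvPolynomial.induction_on with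
  | C r => simp [MvPolynomial.optionEquivLeft_apply, ← MvPolynomial.algebraMap_eq,
      Polynomial.algebraMap_apply]
  | add p q hp hq => simp only [map_add, hp, hq, Polynomial.map_add, Polynomial.eval_add]
  | mul_X p i hp =>
    simp only [map_mul, hp, Polynomial.map_mul, Polynomial.eval_mul]
    congr 1
    cases i <;> simp [MvPolynomial.optionEquivLeft_apply]

/-- A polynomial whose differential at a generic point depends on those of the polynomials in `H`
takes only finitely many values where the latter take given independent values. -/
theorem finite_polyVal {x : ι → ℝ} (hx : AlgebraicIndependent ℚ x) {H : Set K}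
    (hH : LinearIndepOn ℝ (jacRow P x) H) {k : K}
    (hk : jacRow P x k ∈ Submodule.span ℝ (jacRow P x '' H)) {a : K → ℝ}
    (ha : AlgebraicIndepOn ℚ a H) :
    {t | ∃ y : ι → ℝ, (∀ j ∈ H, polyVal P y j = a j) ∧ polyVal P y k = t}.Finite := by
  classical
  by_cases hkH : k ∈ H
  · refine (Set.finite_singleton (a k)).subset ?_
    rintro t ⟨y, hy, rfl⟩
    exact hy k hkH
  have hdep : ¬ AlgebraicIndependent ℚ
      (fun o : Option H => o.elim (polyVal P x k) fun j => polyVal P x j) := by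
    rw [AlgebraicIndependent.option_iff]
    rintro ⟨-, h2⟩
    have h3 := (AlgebraicIndepOn.insert_iff hkH).2
      ⟨algebraicIndepOn_polyVal hx hH, by rwa [Set.image_eq_range]⟩
    exact ((linearIndepOn_insert hkH).1 (linearIndepOn_jacRow h3)).2 hk
  rw [algebraicIndependent_iff] at hdep
  push Not at hdep
  obtain ⟨R, hR, hR0⟩ := hdep
  have hcomp : ∀ y : ι → ℝ, MvPolynomial.aeval
      (fun o : Option H => o.elim (polyVal P y k) fun j => polyVal P y j) R =
      MvPolynomial.aeval y (MvPolynomial.aeval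
        (fun o : Option H => o.elim (P k) fun j => P j) R) := by
    intro y
    rw [← AlgHom.comp_apply, MvPolynomial.comp_aeval]
    congr 2
    ext o
    cases o <;> rfl
  have hid : ∀ y : ι → ℝ, MvPolynomial.aeval
      (fun o : Option H => o.elim (polyVal P y k) fun j => polyVal P y j) R = 0 := by
    intro y
    rw [hcomp, (algebraicIndependent_iff.1 hx) _ ((hcomp x).symm.trans hR), map_zero]
  set f := (MvPolynomial.optionEquivLeft ℚ H R).map
    (MvPolynomial.aeval fun j : H => a j).toRingHom with hf
  have hf0 : f ≠ 0 := by
    rw [hf, Ne, Polynomial.map_eq_zero_iff ha]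
    simpa using hR0
  refine (f.roots.toFinset.finite_toSet).subset ?_
  rintro t ⟨y, hy, rfl⟩
  have h1 : (fun j : H => polyVal P y j) = fun j : H => a j := funext fun j => hy j j.2
  have h2 := hid y
  rw [h1, aeval_option_elim] at h2
  exact (Multiset.mem_toFinset.trans (Polynomial.mem_roots hf0)).2 h2

theorem algebraicIndependent_of_polyVal {y : ι → ℝ} {J : Finset K}
    (hcard : J.card = Fintype.card ι) (h : AlgebraicIndepOn ℚ (polyVal P y) J) :
    AlgebraicIndependent ℚ y := by
  let A := Algebra.adjoin ℚ (Set.range y)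
  let y' : ι → A := fun i => ⟨y i, Algebra.subset_adjoin ⟨i, rfl⟩⟩
  have hy' : Algebra.adjoin ℚ (Set.range y') = ⊤ := by
    rw [← Algebra.adjoin_adjoin_coe_preimage]
    congr 1
    ext z
    simp [y', Subtype.ext_iff]
  have hval : ∀ k, A.val (MvPolynomial.aeval y' (P k)) = polyVal P y k := fun k => by
    rw [polyVal, ← AlgHom.comp_apply, MvPolynomial.comp_aeval]
    rfl
  have hJ : AlgebraicIndependent ℚ (fun j : J => MvPolynomial.aeval y' (P j)) := by
    refine AlgebraicIndependent.of_comp A.val ?_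
    convert h using 1
    ext j
    exact hval j
  have : Algebra.IsAlgebraic (Algebra.adjoin ℚ (Set.range y')) A := by
    rw [hy']
    exact ⟨fun a => isAlgebraic_algebraMap (⟨a, trivial⟩ : (⊤ : Subalgebra ℚ A))⟩
  have hb : IsTranscendenceBasis ℚ y' := by
    refine Algebra.IsAlgebraic.isTranscendenceBasis_of_lift_le_trdeg_of_finite ℚ y' ?_
    have := hJ.lift_cardinalMk_le_trdeg
    simpa [hcard] using this
  exact hb.1.map' (f := A.val) Subtype.val_injective

theorem countable_adjoin {s : Set ℝ} (hs : s.Countable) : Countable (Algebra.adjoin ℚ s) := by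
  have : Countable s := hs
  have : Countable (MvPolynomial s ℚ) := AddMonoidAlgebra.coeff_injective.countable
  rw [Algebra.adjoin_eq_range]
  exact (Set.countable_range (MvPolynomial.aeval (R := ℚ) ((↑) : s → ℝ))).to_subtype

theorem exists_algebraicIndepOn [Finite K] (b : K → ℝ) {H : Set K} (hH : AlgebraicIndepOn ℚ b H)
    {ε : ℝ} (hε : 0 < ε) (J : Set K) :
    ∃ b' : K → ℝ, (∀ j ∈ H, b' j = b j) ∧ (∀ k, |b' k - b k| < ε) ∧ AlgebraicIndepOn ℚ b' J := by
  classical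
  suffices hs : ∀ T : Set K, T.Finite → ∃ b' : K → ℝ, (∀ j ∈ H, b' j = b j) ∧
      (∀ k, |b' k - b k| < ε) ∧ AlgebraicIndepOn ℚ b' (H ∪ T) by
    obtain ⟨b', h1, h2, h3⟩ := hs J (Set.toFinite _)
    exact ⟨b', h1, h2, h3.mono Set.subset_union_right⟩
  intro T hT
  induction T, hT using Set.Finite.induction_on with
  | empty => exact ⟨b, fun _ _ => rfl, by simpa using fun _ => hε, by simpa using hH⟩
  | @insert k T _ _ ih =>
    obtain ⟨b', h1, h2, h3⟩ := ih
    rw [Set.union_insert]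
    by_cases hk : k ∈ H ∪ T
    · rw [Set.insert_eq_of_mem hk]
      exact ⟨b', h1, h2, h3⟩
    have : Countable (Algebra.adjoin ℚ (b' '' (H ∪ T))) :=
      countable_adjoin (Set.toFinite _).countable
    have hd := (Algebraic.countable (Algebra.adjoin ℚ (b' '' (H ∪ T))) ℝ).dense_compl ℝ
    obtain ⟨c, hc, hcb⟩ := hd.exists_dist_lt (b k) hε
    have hne : ∀ j ∈ H ∪ T, Function.update b' k c j = b' j := fun j hj =>
      Function.update_of_ne (ne_of_mem_of_not_mem hj hk) _ _
    refine ⟨Function.update b' k c, fun j hj => (hne j (.inl hj)).trans (h1 j hj), fun j => ?_, ?_⟩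
    · by_cases hj : j = k
      · subst hj
        simpa [Real.dist_eq, abs_sub_comm] using hcb
      · simpa [hj] using h2 j
    · refine (AlgebraicIndepOn.insert_iff hk).2 ⟨?_, ?_⟩
      · have h4 : (fun j : ↥(H ∪ T) => Function.update b' k c j) = fun j : ↥(H ∪ T) => b' j :=
          funext fun j => hne j j.2
        rw [AlgebraicIndepOn, h4]
        exact h3
      · rw [Set.image_congr hne, Function.update_self]
        exact hc

end Algebra

section Analysis

variable {ι K : Type*} [Fintype ι] {P : K → MvPolynomial ι ℚ}

theorem hasStrictFDerivAt_aeval (p : MvPolynomial ι ℚ) (x : ι → ℝ) :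
    HasStrictFDerivAt (fun y : ι → ℝ => MvPolynomial.aeval y p)
      (∑ i, MvPolynomial.aeval x (MvPolynomial.pderiv i p) •
        ContinuousLinearMap.proj (R := ℝ) (φ := fun _ : ι => ℝ) i) x := by
  classical
  induction p using MvPolynomial.induction_on with
  | C a => simpa using hasStrictFDerivAt_const (a : ℝ) x
  | add p q hp hq =>
    simp only [map_add, add_smul, Finset.sum_add_distrib]
    exact hp.add hq
  | mul_X p i hp =>
    have h := hp.mul (ContinuousLinearMap.proj (R := ℝ) (φ := fun _ : ι => ℝ) i).hasStrictFDerivAt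
      (x := x)
    simp only [map_mul, MvPolynomial.aeval_X]
    refine h.congr_fderiv ?_
    ext v
    simp [MvPolynomial.pderiv_X, Derivation.leibniz, add_mul, Finset.sum_add_distrib,
      Finset.mul_sum, Pi.single_apply, apply_ite (MvPolynomial.aeval x), mul_assoc]

theorem continuous_polyVal (k : K) : Continuous fun x : ι → ℝ => polyVal P x k :=
  continuous_iff_continuousAt.2 fun x => (hasStrictFDerivAt_aeval (P k) x).continuousAt

theorem exists_linearIndepOn_superset [Finite K] {r : K → ι → ℝ}
    (hr : Submodule.span ℝ (Set.range r) = ⊤) {S : Set K} (hS : LinearIndepOn ℝ r S) :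
    ∃ J : Finset K, S ⊆ J ∧ LinearIndepOn ℝ r J ∧ J.card = Fintype.card ι := by
  obtain ⟨b, -, hSb, hb, hli⟩ := exists_linearIndepOn_extension hS (Set.subset_univ S)
  have := Fintype.ofFinite b
  refine ⟨b.toFinset, by simpa using hSb, by simpa using hli, ?_⟩
  have h1 : Submodule.span ℝ (r '' b) = ⊤ := by
    rw [Set.image_univ] at hb
    exact top_le_iff.1 (hr ▸ Submodule.span_le.2 hb)
  have h2 := finrank_span_eq_card (R := ℝ) (b := fun j : b => r j) hli
  rw [← Set.image_eq_range, h1, finrank_top, Module.finrank_fintype_fun_eq_card] at h2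
  rw [Set.toFinset_card, h2]

/-- A maximal set of polynomials that are independent at `m` is a local coordinate system. -/
theorem exists_chart [Fintype K] {m : ι → ℝ} {J : Finset K}
    (hJ : LinearIndepOn ℝ (jacRow P m) J) (hcard : J.card = Fintype.card ι) :
    ∃ ε > 0, ∃ ψ : (K → ℝ) → ι → ℝ, ContinuousOn ψ (Metric.ball (polyVal P m) ε) ∧
      (∀ a ∈ Metric.ball (polyVal P m) ε, ∀ j ∈ J, polyVal P (ψ a) j = a j) ∧
      ψ (polyVal P m) = m := by
  classical
  let L : (ι → ℝ) →ₗ[ℝ] J → ℝ := (Matrix.of fun j : J => jacRow P m j).mulVecLin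
  have hsurj : Function.Surjective L := fun w => by
    obtain ⟨v, hv⟩ := exists_dual_vector hJ w
    exact ⟨v, funext hv⟩
  have hfin : Module.finrank ℝ (ι → ℝ) = Module.finrank ℝ (J → ℝ) := by simp [hcard]
  have hinj : Function.Injective L :=
    (LinearMap.injective_iff_surjective_of_finrank_eq_finrank hfin).2 hsurj
  let e : (ι → ℝ) ≃L[ℝ] (J → ℝ) := (LinearEquiv.ofBijective L ⟨hinj, hsurj⟩).toContinuousLinearEquiv
  have hF : HasStrictFDerivAt (fun x : ι → ℝ => fun j : J => polyVal P x j)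
      (e : (ι → ℝ) →L[ℝ] (J → ℝ)) m := by
    refine hasStrictFDerivAt_pi'.2 fun j => (hasStrictFDerivAt_aeval (P j) m).congr_fderiv ?_
    ext v
    simp only [sum_apply, smul_apply,
      ContinuousLinearMap.proj_apply, smul_eq_mul]
    rfl
  let Φ := hF.toOpenPartialHomeomorph
  let ρ : (K → ℝ) → J → ℝ := fun a j => a j
  have hρ : Continuous ρ := by fun_prop
  have ht : polyVal P m ∈ ρ ⁻¹' Φ.target := hF.image_mem_toOpenPartialHomeomorph_target
  obtain ⟨ε, hε, hball⟩ := Metric.isOpen_iff.1 (Φ.open_target.preimage hρ) _ ht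
  refine ⟨ε, hε, fun a => Φ.symm (ρ a), ?_, ?_, ?_⟩
  · exact Φ.continuousOn_symm.comp hρ.continuousOn hball
  · intro a ha j hj
    exact congrFun (Φ.right_inv (hball ha)) ⟨j, hj⟩
  · exact Φ.left_inv hF.mem_toOpenPartialHomeomorph_source

theorem polyVal_eq_of_isPreconnected {p : ι → ℝ} (hp : AlgebraicIndependent ℚ p) {H : Set K}
    (hH : LinearIndepOn ℝ (jacRow P p) H) {k : K}
    (hk : jacRow P p k ∈ Submodule.span ℝ (jacRow P p '' H)) {T : Type*} [TopologicalSpace T]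
    {S : Set T} (hS : IsPreconnected S) {ψ : T → ι → ℝ} (hψ : ContinuousOn ψ S) {c : K → ℝ}
    (hc : AlgebraicIndepOn ℚ c H) (hval : ∀ s ∈ S, ∀ j ∈ H, polyVal P (ψ s) j = c j)
    {s t : T} (hs : s ∈ S) (ht : t ∈ S) : polyVal P (ψ s) k = polyVal P (ψ t) k := by
  have hfin := finite_polyVal hp hH hk hc
  have himg := hS.image _ ((continuous_polyVal (P := P) k).comp_continuousOn hψ)
  refine hfin.countable.isTotallyDisconnected _ ?_ himg ⟨s, hs, rfl⟩ ⟨t, ht, rfl⟩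
  rintro _ ⟨r, hr, rfl⟩
  exact ⟨ψ r, hval r hr, rfl⟩

theorem update_mem_ball [Fintype K] [DecidableEq K] {b : K → ℝ} {z : K} {s ε : ℝ}
    (h : |s - b z| < ε) : Function.update b z s ∈ Metric.ball b ε := by
  have hε : 0 < ε := (abs_nonneg _).trans_lt h
  rw [Metric.mem_ball, dist_pi_lt_iff hε]
  intro k
  by_cases hk : k = z
  · subst hk
    simpa [Real.dist_eq] using h
  · simpa [hk] using hε

/-- Moving the coordinate `z` in a chart. -/
theorem exists_flex [Fintype K] (hspan : ∀ m, Submodule.span ℝ (Set.range (jacRow P m)) = ⊤)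
    {p m : ι → ℝ} (hp : AlgebraicIndependent ℚ p) {H : Set K}
    (hH : LinearIndepOn ℝ (jacRow P p) H) {z : K} (hz : z ∉ H)
    (hm : LinearIndepOn ℝ (jacRow P m) (insert z H))
    (hval : ∀ j ∈ H, polyVal P m j = polyVal P p j) :
    ∃ q, polyVal P q z ≠ polyVal P m z ∧
      ∀ k, jacRow P p k ∈ Submodule.span ℝ (jacRow P p '' H) → polyVal P q k = polyVal P m k := by
  classical
  obtain ⟨J, hJs, hJ, hcard⟩ := exists_linearIndepOn_superset (hspan m) hm
  obtain ⟨ε, hε, ψ, hψ, hψJ, hψm⟩ := exists_chart hJ hcard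
  set b := polyVal P m
  have hball : ∀ t ∈ Set.Icc 0 (ε / 2), Function.update b z (b z + t) ∈ Metric.ball b ε := by
    intro t ht
    refine update_mem_ball ?_
    rw [add_sub_cancel_left, abs_of_nonneg ht.1]
    linarith [ht.2]
  have hψ' : ContinuousOn (fun t => ψ (Function.update b z (b z + t))) (Set.Icc 0 (ε / 2)) :=
    hψ.comp (by fun_prop) hball
  have h0 : (0 : ℝ) ∈ Set.Icc 0 (ε / 2) := ⟨le_rfl, by positivity⟩
  have h1 : ε / 2 ∈ Set.Icc 0 (ε / 2) := ⟨by positivity, le_rfl⟩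
  refine ⟨ψ (Function.update b z (b z + ε / 2)), ?_, fun k hk => ?_⟩
  · rw [hψJ _ (hball _ h1) z (hJs (Set.mem_insert _ _)), Function.update_self]
    linarith
  · have := polyVal_eq_of_isPreconnected hp hH hk isPreconnected_Icc hψ'
      (algebraicIndepOn_polyVal hp hH) (fun t ht j hj => ?_) h1 h0
    · simpa [hψm, b] using this
    · rw [hψJ _ (hball t ht) j (hJs (Set.mem_insert_of_mem _ hj)),
        Function.update_of_ne (ne_of_mem_of_not_mem hj hz)]
      exact hval j hj

theorem jacRow_notMem_span [Fintype K]
    (hspan : ∀ m, Submodule.span ℝ (Set.range (jacRow P m)) = ⊤)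
    {p m : ι → ℝ} (hp : AlgebraicIndependent ℚ p) {H : Set K}
    (hH : LinearIndepOn ℝ (jacRow P p) H) {z : K} (hz : z ∉ H)
    (hm : LinearIndepOn ℝ (jacRow P m) (insert z H))
    (hval : ∀ j ∈ H, polyVal P m j = polyVal P p j) :
    jacRow P p z ∉ Submodule.span ℝ (jacRow P p '' H) := by
  intro hk
  obtain ⟨q, hq, hqk⟩ := exists_flex hspan hp hH hz hm hval
  exact hq (hqk z hk)

theorem jacRow_mem_span_of_forall [Fintype K]
    (hspan : ∀ m, Submodule.span ℝ (Set.range (jacRow P m)) = ⊤)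
    {p : ι → ℝ} (hp : AlgebraicIndependent ℚ p) {E : Set K} {k : K}
    (h : ∀ q, (∀ j ∈ E, polyVal P q j = polyVal P p j) → polyVal P q k = polyVal P p k) :
    jacRow P p k ∈ Submodule.span ℝ (jacRow P p '' E) := by
  obtain ⟨H, hHE, -, hH, hli⟩ := exists_linearIndepOn_extension
    (linearIndepOn_empty ℝ (jacRow P p)) (Set.empty_subset E)
  by_contra hk
  have hk' : jacRow P p k ∉ Submodule.span ℝ (jacRow P p '' H) :=
    fun hk' => hk (Submodule.span_mono (Set.image_mono hHE) hk')
  have hkH : k ∉ H := fun hkH => hk' (Submodule.subset_span ⟨k, hkH, rfl⟩)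
  obtain ⟨q, hq, hqk⟩ := exists_flex hspan hp hli hkH ((linearIndepOn_insert hkH).2 ⟨hli, hk'⟩)
    fun _ _ => rfl
  exact hq (h q fun j hj => hqk j (hH ⟨j, hj, rfl⟩))

/-- If a placement `m` maximizes the value of `e` on a fibre which has dimension one modulo `H`,
then near `m` there are two placements, one of them generic, distinguished by `z` only. -/
theorem false_of_isMax [Fintype K]
    (hspan : ∀ m, Submodule.span ℝ (Set.range (jacRow P m)) = ⊤)
    {p m : ι → ℝ} (hp : AlgebraicIndependent ℚ p) {H E : Set K} {e z : K} (hz : z ∉ H)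
    (hHE : H ⊆ E) (hH : LinearIndepOn ℝ (jacRow P p) (insert z H))
    (hm : LinearIndepOn ℝ (jacRow P m) (insert z H))
    (hE : ∀ k ∈ E, jacRow P p k ∈ Submodule.span ℝ (jacRow P p '' H))
    (he : jacRow P p e ∈ Submodule.span ℝ (jacRow P p '' insert z H))
    (hval : ∀ j ∈ E, polyVal P m j = polyVal P p j)
    (hmax : ∀ q, (∀ j ∈ E, polyVal P q j = polyVal P p j) → polyVal P q e ≤ polyVal P m e)
    (hglob : ∀ q, AlgebraicIndependent ℚ q → ∀ q', (∀ j ∈ E, polyVal P q' j = polyVal P q j) →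
      polyVal P q' e = polyVal P q e → polyVal P q' z = polyVal P q z) : False := by
  classical
  have hHp : LinearIndepOn ℝ (jacRow P p) H := hH.mono (Set.subset_insert _ _)
  obtain ⟨J, hJs, hJ, hcard⟩ := exists_linearIndepOn_superset (hspan m) hm
  obtain ⟨ε, hε, ψ, hψ, hψJ, hψm⟩ := exists_chart hJ hcard
  set b₀ := polyVal P m with hb₀
  have hb₀ball : b₀ ∈ Metric.ball b₀ ε := Metric.mem_ball_self hε
  have hb₀H : AlgebraicIndepOn ℚ b₀ H := by
    have h1 : (fun j : H => b₀ j) = fun j : H => polyVal P p j :=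
      funext fun j => hval j (hHE j.2)
    rw [AlgebraicIndepOn, h1]
    exact algebraicIndepOn_polyVal hp hHp
  have hsegball : ∀ a ∈ Metric.ball b₀ ε, ∀ b ∈ Metric.ball b₀ ε,
      segment ℝ a b ⊆ Metric.ball b₀ ε := fun a ha b hb => (convex_ball b₀ ε).segment_subset ha hb
  have hseg : ∀ a ∈ Metric.ball b₀ ε, ∀ b ∈ Metric.ball b₀ ε, ∀ S ⊆ insert z H,
      LinearIndepOn ℝ (jacRow P p) S → AlgebraicIndepOn ℚ a S → (∀ j ∈ S, b j = a j) →
      ∀ k, jacRow P p k ∈ Submodule.span ℝ (jacRow P p '' S) →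
        polyVal P (ψ a) k = polyVal P (ψ b) k := by
    intro a ha b hb S hS hli hai hab k hk
    refine polyVal_eq_of_isPreconnected hp hli hk (convex_segment a b).isPreconnected
      (hψ.mono (hsegball a ha b hb)) hai (fun c hc j hj => ?_)
      (left_mem_segment ℝ a b) (right_mem_segment ℝ a b)
    rw [hψJ c (hsegball a ha b hb hc) j (hJs (hS hj))]
    obtain ⟨x, y, -, -, hxy, rfl⟩ := hc
    simp [hab j hj, ← add_mul, hxy]
  have hfib : ∀ a ∈ Metric.ball b₀ ε, (∀ j ∈ H, a j = b₀ j) → ∀ j ∈ E,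
      polyVal P (ψ a) j = polyVal P p j := by
    intro a ha haH j hj
    rw [← hseg b₀ hb₀ball a ha H (Set.subset_insert _ _) hHp hb₀H haH j (hE j hj), hψm]
    exact hval j hj
  let β : ℝ → K → ℝ := fun s => Function.update b₀ z s
  have hβH : ∀ s, ∀ j ∈ H, β s j = b₀ j := fun s j hj =>
    Function.update_of_ne (ne_of_mem_of_not_mem hj hz) _ _
  have hβz : ∀ s, β s z = s := fun s => Function.update_self _ _ _
  have hβball : ∀ s ∈ Metric.ball (b₀ z) ε, β s ∈ Metric.ball b₀ ε := fun s hs =>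
    update_mem_ball (by simpa [Real.dist_eq] using hs)
  let g : ℝ → ℝ := fun s => polyVal P (ψ (β s)) e
  have hg : ContinuousOn g (Metric.ball (b₀ z) ε) :=
    (continuous_polyVal e).comp_continuousOn (hψ.comp (by fun_prop) hβball)
  have hg0 : g (b₀ z) = polyVal P m e := by simp [g, β, hψm]
  have key : ∀ s₁ ∈ Metric.ball (b₀ z) ε, ∀ b ∈ Metric.ball b₀ ε, (∀ j ∈ H, b j = b₀ j) →
      AlgebraicIndepOn ℚ b J → (s₁ - b₀ z) * (b z - b₀ z) < 0 → ¬ g s₁ ≤ g (b z) := by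
    intro s₁ hs₁ b hb hbH hbJ hlt hle
    have hbz : b z ∈ Metric.ball (b₀ z) ε := (dist_le_pi_dist b b₀ z).trans_lt hb
    have hge : polyVal P (ψ b) e = g (b z) := by
      refine hseg b hb _ (hβball _ hbz) _ subset_rfl hH (hbJ.mono hJs) (fun j hj => ?_) e he
      rcases hj with rfl | hj
      · exact hβz _
      · rw [hbH j hj]
        exact hβH _ j hj
    have hmaxb : g (b z) ≤ g (b₀ z) := by
      rw [← hge, hg0]
      exact hmax _ (hfib b hb hbH)
    have hsub : Set.uIcc s₁ (b₀ z) ⊆ Metric.ball (b₀ z) ε :=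
      (segment_eq_uIcc s₁ (b₀ z)).symm ▸
        (convex_ball (b₀ z) ε).segment_subset hs₁ (Metric.mem_ball_self hε)
    obtain ⟨s, hs, hgs⟩ := intermediate_value_uIcc (hg.mono hsub)
      (Set.Icc_subset_uIcc ⟨hle, hmaxb⟩)
    have hsb : s ≠ b z := by
      rintro rfl
      rcases Set.mem_uIcc.1 hs with h | h <;> nlinarith
    refine hsb ?_
    have := hglob (ψ b)
      (algebraicIndependent_of_polyVal (P := P) hcard ?_) (ψ (β s)) (fun j hj => ?_) ?_
    · rwa [hψJ _ (hβball s (hsub hs)) z (hJs (Set.mem_insert _ _)),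
        hψJ _ hb z (hJs (Set.mem_insert _ _)), hβz] at this
    · have h1 : (fun j : (J : Set K) => polyVal P (ψ b) j) = fun j : (J : Set K) => b j :=
        funext fun j => hψJ b hb j j.2
      rw [AlgebraicIndepOn, h1]
      exact hbJ
    · rw [hfib _ (hβball s (hsub hs)) (hβH s) j hj, hfib b hb hbH j hj]
    · rw [hge]
      exact hgs
  have hpick : ∀ s, |s - b₀ z| = ε / 2 → ∃ b ∈ Metric.ball b₀ ε, (∀ j ∈ H, b j = b₀ j) ∧
      AlgebraicIndepOn ℚ b J ∧ |b z - s| < ε / 4 := by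
    intro s hs
    have h1 : AlgebraicIndepOn ℚ (β s) H := by
      rw [AlgebraicIndepOn, show (fun j : H => β s j) = fun j : H => b₀ j from
        funext fun j => hβH s j j.2]
      exact hb₀H
    obtain ⟨b, hbH, hbd, hbJ⟩ := exists_algebraicIndepOn (β s) h1 (ε := ε / 4) (by positivity) J
    refine ⟨b, ?_, fun j hj => (hbH j hj).trans (hβH s j hj), hbJ, by simpa [β] using hbd z⟩
    rw [Metric.mem_ball, dist_pi_lt_iff hε]
    intro k
    have h2 := hbd k
    by_cases hk : k = z
    · subst hk
      simp only [β, Function.update_self] at h2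
      calc dist (b k) (b₀ k) ≤ |b k - s| + |s - b₀ k| := abs_sub_le _ _ _
        _ < ε := by linarith
    · simp only [β, Function.update_of_ne hk] at h2
      exact h2.trans (by linarith)
  obtain ⟨b₁, hb₁, hb₁H, hb₁J, hb₁z⟩ := hpick (b₀ z - ε / 2) (by
    rw [sub_sub_cancel_left, abs_neg, abs_of_pos (by positivity)])
  obtain ⟨b₂, hb₂, hb₂H, hb₂J, hb₂z⟩ := hpick (b₀ z + ε / 2) (by
    rw [add_sub_cancel_left, abs_of_pos (by positivity)])
  rw [abs_lt] at hb₁z hb₂z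
  have hlt : (b₁ z - b₀ z) * (b₂ z - b₀ z) < 0 :=
    mul_neg_of_neg_of_pos (by linarith) (by linarith)
  have hz₁ : b₁ z ∈ Metric.ball (b₀ z) ε := (dist_le_pi_dist b₁ b₀ z).trans_lt hb₁
  have hz₂ : b₂ z ∈ Metric.ball (b₀ z) ε := (dist_le_pi_dist b₂ b₀ z).trans_lt hb₂
  rcases le_total (g (b₁ z)) (g (b₂ z)) with h | h
  · exact key _ hz₁ b₂ hb₂ hb₂H hb₂J hlt h
  · exact key _ hz₂ b₁ hb₁ hb₁H hb₁J (by rwa [mul_comm]) h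

end Analysis

section Plane

/-- The squared distances of pairs of points in the plane together with all coordinates, as
polynomials in the coordinates. -/
def planePoly : (V × V) ⊕ (V × Fin 2) → MvPolynomial (V × Fin 2) ℚ
  | .inl ab => ∑ i, (MvPolynomial.X (ab.1, i) - MvPolynomial.X (ab.2, i)) ^ 2
  | .inr i => MvPolynomial.X i

theorem planePoly_swap (a b : V) : planePoly (.inl (a, b)) = planePoly (.inl (b, a)) :=
  Finset.sum_congr rfl fun i _ => by ring

theorem polyVal_inl (x : V × Fin 2 → ℝ) (a b : V) :
    polyVal planePoly x (.inl (a, b)) =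
      (x (a, 0) - x (b, 0)) ^ 2 + (x (a, 1) - x (b, 1)) ^ 2 := by
  simp [polyVal, planePoly]

theorem polyVal_swap (x : V × Fin 2 → ℝ) (a b : V) :
    polyVal planePoly x (.inl (a, b)) = polyVal planePoly x (.inl (b, a)) := by
  rw [polyVal, planePoly_swap, polyVal]

theorem jacRow_swap (x : V × Fin 2 → ℝ) (a b : V) :
    jacRow planePoly x (.inl (a, b)) = jacRow planePoly x (.inl (b, a)) := by
  ext i
  rw [jacRow, planePoly_swap, jacRow]

theorem jacRow_inl_dotProduct [Fintype V] (x y : V × Fin 2 → ℝ) (a b : V) :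
    jacRow planePoly x (.inl (a, b)) ⬝ᵥ y =
      2 * ((x (a, 0) - x (b, 0)) * (y (a, 0) - y (b, 0)) +
        (x (a, 1) - x (b, 1)) * (y (a, 1) - y (b, 1))) := by
  classical
  have h : ∀ i c, MvPolynomial.aeval x (MvPolynomial.pderiv i
      (MvPolynomial.X c : MvPolynomial (V × Fin 2) ℚ)) = if c = i then 1 else 0 := fun i c => by
    rw [MvPolynomial.pderiv_X, Pi.single_apply]
    split_ifs <;> simp
  simp only [jacRow, dotProduct, planePoly, Fin.sum_univ_two, map_add, map_sub,
    Derivation.leibniz_pow, h, nsmul_eq_mul, smul_eq_mul, map_mul, map_pow, MvPolynomial.aeval_X,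
    map_natCast]
  have h2 : ∀ c, y c = ∑ i, (if c = i then 1 else 0) * y i := fun c => by simp
  simp only [h2 (a, _), h2 (b, _), ← Finset.sum_sub_distrib, Finset.mul_sum,
    ← Finset.sum_add_distrib]
  refine Finset.sum_congr rfl fun i _ => ?_
  push_cast
  ring

theorem span_jacRow_planePoly [Fintype V] (x : V × Fin 2 → ℝ) :
    Submodule.span ℝ (Set.range (jacRow planePoly x)) = ⊤ := by
  classical
  rw [eq_top_iff, ← (Pi.basisFun ℝ (V × Fin 2)).span_eq, Submodule.span_le]
  rintro _ ⟨i, rfl⟩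
  refine Submodule.subset_span ⟨.inr i, ?_⟩
  ext j
  simp only [jacRow, planePoly, MvPolynomial.pderiv_X, Pi.basisFun_apply, Pi.single_apply]
  by_cases h : i = j
  · simp [h]
  · simp [h, Ne.symm h]

/-- The row space of the rigidity matrix of the complete framework at `x`. -/
def rowSpace (x : V × Fin 2 → ℝ) : Submodule ℝ (V × Fin 2 → ℝ) :=
  Submodule.span ℝ (Set.range fun ab : V × V => jacRow planePoly x (.inl ab))

/-- The space of trivial infinitesimal motions at `x`. -/
def motionSpace [Fintype V] (x : V × Fin 2 → ℝ) : Submodule ℝ (V × Fin 2 → ℝ) :=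
  LinearMap.ker (Matrix.of fun ab : V × V => jacRow planePoly x (.inl ab)).mulVecLin

theorem mem_motionSpace [Fintype V] {x y : V × Fin 2 → ℝ} :
    y ∈ motionSpace x ↔ ∀ a b, (x (a, 0) - x (b, 0)) * (y (a, 0) - y (b, 0)) +
        (x (a, 1) - x (b, 1)) * (y (a, 1) - y (b, 1)) = 0 := by
  rw [motionSpace, LinearMap.mem_ker, Matrix.mulVecLin_apply, funext_iff, Prod.forall]
  refine forall₂_congr fun a b => ?_
  change jacRow planePoly x (.inl (a, b)) ⬝ᵥ y = 0 ↔ _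
  rw [jacRow_inl_dotProduct]
  simp

theorem finrank_rowSpace_add [Fintype V] (x : V × Fin 2 → ℝ) :
    Module.finrank ℝ (rowSpace x) + Module.finrank ℝ (motionSpace x) = 2 * Fintype.card V := by
  have h := LinearMap.finrank_range_add_finrank_ker
    (Matrix.of fun ab : V × V => jacRow planePoly x (.inl ab)).mulVecLin
  have h2 := Matrix.rank_eq_finrank_span_row
    (Matrix.of fun ab : V × V => jacRow planePoly x (.inl ab))
  rw [Matrix.rank] at h2
  rw [h2, Module.finrank_fintype_fun_eq_card, Fintype.card_prod, Fintype.card_fin, mul_comm] at h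
  exact h

/-- Twice the signed area of the triangle `u v c`. -/
def area (x : V × Fin 2 → ℝ) (u v c : V) : ℝ :=
  (x (v, 0) - x (u, 0)) * (x (c, 1) - x (u, 1)) - (x (v, 1) - x (u, 1)) * (x (c, 0) - x (u, 0))

theorem two_mul_card_le_of_area_ne_zero [Fintype V] {x : V × Fin 2 → ℝ} {u v c : V}
    (h : area x u v c ≠ 0) : 2 * Fintype.card V ≤ Module.finrank ℝ (rowSpace x) + 3 := by
  have hker : Module.finrank ℝ (motionSpace x) ≤ 3 := by
    let π : V → Fin 2 → ((V × Fin 2 → ℝ) →ₗ[ℝ] ℝ) := fun w i => LinearMap.proj (w, i)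
    let f : (V × Fin 2 → ℝ) →ₗ[ℝ] Fin 3 → ℝ := LinearMap.pi
      ![π u 0, π u 1, (x (v, 0) - x (u, 0)) • (π v 1 - π u 1) -
        (x (v, 1) - x (u, 1)) • (π v 0 - π u 0)]
    have hinj : Function.Injective (f ∘ₗ (motionSpace x).subtype) := by
      rw [← LinearMap.ker_eq_bot, LinearMap.ker_eq_bot']
      rintro ⟨y, hy⟩ hfy
      rw [mem_motionSpace] at hy
      have h0 : y (u, 0) = 0 := by simpa [f, π] using congrFun hfy 0
      have h1 : y (u, 1) = 0 := by simpa [f, π] using congrFun hfy 1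
      have h2 : (x (v, 0) - x (u, 0)) * y (v, 1) - (x (v, 1) - x (u, 1)) * y (v, 0) = 0 := by
        simpa [f, π, h0, h1] using congrFun hfy 2
      have zero_of : ∀ {a b a' b' s t : ℝ}, a * b' - b * a' ≠ 0 → a * s + b * t = 0 →
          a' * s + b' * t = 0 → s = 0 ∧ t = 0 := by
        intro a b a' b' s t hne e1 e2
        constructor
        · refine (mul_eq_zero.1 ?_).resolve_left hne
          linear_combination b' * e1 - b * e2
        · refine (mul_eq_zero.1 ?_).resolve_left hne
          linear_combination a * e2 - a' * e1
      have hd : (x (v, 0) - x (u, 0)) * (x (v, 0) - x (u, 0)) -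
          (x (v, 1) - x (u, 1)) * -(x (v, 1) - x (u, 1)) ≠ 0 := by
        intro h3
        obtain ⟨h4, h5⟩ := mul_self_add_mul_self_eq_zero.1
          (show (x (v, 0) - x (u, 0)) * (x (v, 0) - x (u, 0)) +
            (x (v, 1) - x (u, 1)) * (x (v, 1) - x (u, 1)) = 0 by linear_combination h3)
        exact h (by rw [area, h4, h5]; ring)
      have huv := hy v u
      rw [h0, h1] at huv
      obtain ⟨hv0, hv1⟩ := zero_of hd (s := y (v, 0)) (t := y (v, 1))
        (by linear_combination huv) (by linear_combination h2)
      have huc := hy c u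
      have hvc := hy c v
      rw [h0, h1] at huc
      rw [hv0, hv1] at hvc
      rw [area] at h
      obtain ⟨hc0, hc1⟩ := zero_of h (s := y (c, 0)) (t := y (c, 1))
        (by linear_combination huc - hvc) (by linear_combination huc)
      have hw : ∀ w, y (w, 0) = 0 ∧ y (w, 1) = 0 := by
        intro w
        have e1 := hy w u
        have e2 := hy w v
        have e3 := hy w c
        rw [h0, h1] at e1
        rw [hv0, hv1] at e2
        rw [hc0, hc1] at e3
        exact zero_of h (by linear_combination e1 - e2) (by linear_combination e1 - e3)
      ext ⟨w, i⟩
      fin_cases i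
      exacts [(hw w).1, (hw w).2]
    simpa using LinearMap.finrank_le_finrank_of_injective hinj
  have := finrank_rowSpace_add x
  omega

theorem finrank_rowSpace_add_three_le [Fintype V] {x : V × Fin 2 → ℝ} {u v c : V}
    (h : area x u v c ≠ 0) : Module.finrank ℝ (rowSpace x) + 3 ≤ 2 * Fintype.card V := by
  have hker : 3 ≤ Module.finrank ℝ (motionSpace x) := by
    let f : (Fin 3 → ℝ) →ₗ[ℝ] V × Fin 2 → ℝ := LinearMap.pi fun ci =>
      ![LinearMap.proj 0 - x (ci.1, 1) • LinearMap.proj 2,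
        LinearMap.proj 1 + x (ci.1, 0) • LinearMap.proj 2] ci.2
    have hf : ∀ y, f y ∈ motionSpace x := fun y => by
      rw [mem_motionSpace]
      intro a b
      simp [f]
      ring
    have hinj : Function.Injective (f.codRestrict _ hf) := by
      rw [← LinearMap.ker_eq_bot, LinearMap.ker_eq_bot']
      intro y hy
      have hy' : ∀ ci, f y ci = 0 := fun ci => congrFun (congrArg Subtype.val hy) ci
      have hu0 : y 0 - x (u, 1) * y 2 = 0 := by simpa [f] using hy' (u, 0)
      have hu1 : y 1 + x (u, 0) * y 2 = 0 := by simpa [f] using hy' (u, 1)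
      have hv0 : y 0 - x (v, 1) * y 2 = 0 := by simpa [f] using hy' (v, 0)
      have hv1 : y 1 + x (v, 0) * y 2 = 0 := by simpa [f] using hy' (v, 1)
      have h2 : y 2 = 0 := by
        refine (mul_eq_zero.1 ?_).resolve_left h
        rw [area]
        linear_combination (x (c, 1) - x (u, 1)) * (hv1 - hu1) +
          (x (c, 0) - x (u, 0)) * (hv0 - hu0)
      ext i
      fin_cases i
      · simpa [h2] using hu0
      · simpa [h2] using hu1
      · exact h2
    simpa using LinearMap.finrank_le_finrank_of_injective hinj
  have := finrank_rowSpace_add x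
  omega

theorem finrank_rowSpace_lt_of_area_eq_zero [Fintype V] {x : V × Fin 2 → ℝ} {u v : V}
    (huv : polyVal planePoly x (.inl (u, v)) ≠ 0) (h : ∀ c, area x u v c = 0) :
    Module.finrank ℝ (rowSpace x) < Fintype.card V := by
  have hker : Fintype.card V + 1 ≤ Module.finrank ℝ (motionSpace x) := by
    set d : Fin 2 → ℝ := fun i => x (v, i) - x (u, i) with hd
    let f : ((V → ℝ) × ℝ) →ₗ[ℝ] V × Fin 2 → ℝ := LinearMap.pi fun ci =>
      ![-d 1 • (LinearMap.proj ci.1 ∘ₗ LinearMap.fst ℝ (V → ℝ) ℝ) + d 0 • LinearMap.snd ℝ _ _,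
        d 0 • (LinearMap.proj ci.1 ∘ₗ LinearMap.fst ℝ (V → ℝ) ℝ) + d 1 • LinearMap.snd ℝ _ _] ci.2
    have hf : ∀ y, f y ∈ motionSpace x := fun y => by
      rw [mem_motionSpace]
      intro a b
      have ha := h a
      have hb := h b
      rw [area] at ha hb
      simp only [f, hd, LinearMap.pi_apply, Matrix.cons_val_zero, Matrix.cons_val_one,
        LinearMap.add_apply, LinearMap.smul_apply, LinearMap.comp_apply, LinearMap.proj_apply,
        LinearMap.fst_apply, LinearMap.snd_apply, smul_eq_mul]
      linear_combination (y.1 a - y.1 b) * (ha - hb)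
    have hd0 : d 0 ^ 2 + d 1 ^ 2 ≠ 0 := fun h0 => huv (by
      rw [polyVal_inl]
      linear_combination h0)
    have hinj : Function.Injective (f.codRestrict _ hf) := by
      rw [← LinearMap.ker_eq_bot, LinearMap.ker_eq_bot']
      rintro ⟨s, t⟩ hy
      have hy' : ∀ ci, f (s, t) ci = 0 := fun ci => congrFun (congrArg Subtype.val hy) ci
      have h0 : ∀ w, -d 1 * s w + d 0 * t = 0 := fun w => by simpa [f] using hy' (w, 0)
      have h1 : ∀ w, d 0 * s w + d 1 * t = 0 := fun w => by simpa [f] using hy' (w, 1)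
      refine Prod.ext (funext fun w => ?_) ?_
      · refine (mul_eq_zero.1 ?_).resolve_left hd0
        linear_combination d 0 * h1 w - d 1 * h0 w
      · refine (mul_eq_zero.1 ?_).resolve_left hd0
        linear_combination d 0 * h0 u + d 1 * h1 u
    simpa using LinearMap.finrank_le_finrank_of_injective hinj
  have := finrank_rowSpace_add x
  omega

theorem aeval_ne_zero_of_algebraicIndependent {ι : Type*} {p : ι → ℝ}
    (hp : AlgebraicIndependent ℚ p) {Q : MvPolynomial ι ℚ} (f : ι → ℚ)
    (hf : MvPolynomial.eval f Q ≠ 0) : MvPolynomial.aeval p Q ≠ 0 := by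
  intro h
  rw [algebraicIndependent_iff.1 hp Q h, map_zero] at hf
  exact hf rfl

theorem area_ne_zero_of_algebraicIndependent {p : V × Fin 2 → ℝ} (hp : AlgebraicIndependent ℚ p)
    {u v c : V} (huv : u ≠ v) (huc : u ≠ c) (hvc : v ≠ c) : area p u v c ≠ 0 := by
  classical
  have := aeval_ne_zero_of_algebraicIndependent hp
    (Q := (.X (v, 0) - .X (u, 0)) * (.X (c, 1) - .X (u, 1)) -
      (.X (v, 1) - .X (u, 1)) * (.X (c, 0) - .X (u, 0)))
    (fun i => if i = (v, 0) ∨ i = (c, 1) then 1 else 0) (by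
      simp [huv, huc, hvc.symm, hvc])
  simpa [area] using this

theorem inner_ne_zero_of_algebraicIndependent {p : V × Fin 2 → ℝ} (hp : AlgebraicIndependent ℚ p)
    {u v c : V} (huv : u ≠ v) (huc : u ≠ c) :
    (p (v, 0) - p (u, 0)) * (p (c, 0) - p (u, 0)) +
      (p (v, 1) - p (u, 1)) * (p (c, 1) - p (u, 1)) ≠ 0 := by
  classical
  have := aeval_ne_zero_of_algebraicIndependent hp
    (Q := (.X (v, 0) - .X (u, 0)) * (.X (c, 0) - .X (u, 0)) +
      (.X (v, 1) - .X (u, 1)) * (.X (c, 1) - .X (u, 1)))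
    (fun i => if i = (v, 0) ∨ i = (c, 0) then 1 else 0) (by
      simp [huv, huc])
  simpa using this

theorem eDist_eq_iff {p q : V × Fin 2 → ℝ} {a b : V} :
    eDist (fun i => p (a, i)) (fun i => p (b, i)) = eDist (fun i => q (a, i)) (fun i => q (b, i)) ↔
      polyVal planePoly p (.inl (a, b)) = polyVal planePoly q (.inl (a, b)) := by
  simp only [eDist, Fin.sum_univ_two, polyVal_inl]
  exact Real.sqrt_inj (by positivity) (by positivity)

theorem eq_of_reflection {G : SimpleGraph V} {p : V × Fin 2 → ℝ} (hp : AlgebraicIndependent ℚ p)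
    (hG : ∀ q, (∀ a b, G.Adj a b →
      polyVal planePoly q (.inl (a, b)) = polyVal planePoly p (.inl (a, b))) →
      ∀ a b, polyVal planePoly q (.inl (a, b)) = polyVal planePoly p (.inl (a, b)))
    {B : Set V} {c : V} (hc : c ∉ B) (hB : ∀ x ∈ B, ∀ w ∉ B, G.Adj x w → w = c)
    {x w : V} (hx : x ∈ B) (hw : w ∉ B) : w = c := by
  classical
  by_contra hwc
  let q : V × Fin 2 → ℝ := fun i => if i.1 ∈ B then 2 * p (c, i.2) - p i else p i
  have hq := hG q (fun a b hab => by
    simp only [polyVal_inl, q]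
    by_cases ha : a ∈ B <;> by_cases hb : b ∈ B
    · simp only [ha, hb, if_true]
      ring
    · obtain rfl := hB a ha b hb hab
      simp only [ha, hb, if_true, if_false]
      ring
    · obtain rfl := hB b hb a ha hab.symm
      simp only [ha, hb, if_true, if_false]
      ring
    · simp only [ha, hb, if_false]) x w
  simp only [polyVal_inl, q, hx, hw, if_true, if_false] at hq
  refine inner_ne_zero_of_algebraicIndependent hp (u := c) (v := w) (c := x)
    (Ne.symm hwc) (fun h => hc (h ▸ hx)) ?_
  linear_combination hq / 4

theorem reachable_deleteEdges [Fintype V] {G : SimpleGraph V} (hV : 3 ≤ Fintype.card V)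
    {p : V × Fin 2 → ℝ} (hp : AlgebraicIndependent ℚ p)
    (hG : ∀ q, (∀ a b, G.Adj a b →
      polyVal planePoly q (.inl (a, b)) = polyVal planePoly p (.inl (a, b))) →
      ∀ a b, polyVal planePoly q (.inl (a, b)) = polyVal planePoly p (.inl (a, b)))
    {u v : V} (huv : G.Adj u v) (w : V) : (G.deleteEdges {s(u, v)}).Reachable u w := by
  classical
  by_contra hw
  set G' := G.deleteEdges {s(u, v)} with hG'
  have hstep : ∀ a b, G'.Reachable u a → ¬ G'.Reachable u b → G.Adj b a → a = u ∧ b = v := by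
    intro a b ha hb hab
    have h1 : s(a, b) = s(u, v) := by
      by_contra h1
      exact hb (ha.trans (SimpleGraph.Adj.reachable
        (by simpa [hG', SimpleGraph.deleteEdges_adj] using ⟨hab.symm, by simpa using h1⟩)))
    rcases Sym2.eq_iff.1 h1 with h | ⟨-, rfl⟩
    · exact h
    · exact absurd (SimpleGraph.Reachable.refl _) hb
  have huniq : ∀ a, G'.Reachable u a → a = u := fun a ha =>
    eq_of_reflection hp hG (B := {b | ¬ G'.Reachable u b}) (c := u)
      (not_not.2 (SimpleGraph.Reachable.refl _))
      (fun x hx y hy hxy => (hstep y x (not_not.1 hy) hx hxy).1) hw (not_not.2 ha)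
  obtain ⟨c, hc⟩ : ∃ c, c ∉ ({u, v} : Finset V) := by
    by_contra! h
    have := Finset.card_le_card fun x (_ : x ∈ Finset.univ) => h x
    have := Finset.card_le_two (a := u) (b := v)
    rw [Finset.card_univ] at *
    omega
  rw [Finset.mem_insert, Finset.mem_singleton, not_or] at hc
  refine hc.2 (eq_of_reflection hp hG (B := {u}) (c := v) huv.ne' ?_ rfl hc.1)
  rintro x rfl y hy hxy
  exact (hstep x y (SimpleGraph.Reachable.refl _) (fun h => hy (huniq y h)) hxy.symm).2

/-- On the placements with prescribed lengths of the edges of a connected graph, the distance of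
two given vertices attains its maximum. -/
theorem exists_isMax [Fintype V] {G : SimpleGraph V} {u : V} (hu : ∀ w, G.Reachable u w)
    (p : V × Fin 2 → ℝ) (v : V) :
    ∃ m, (∀ a b, G.Adj a b →
        polyVal planePoly m (.inl (a, b)) = polyVal planePoly p (.inl (a, b))) ∧
      ∀ q, (∀ a b, G.Adj a b →
          polyVal planePoly q (.inl (a, b)) = polyVal planePoly p (.inl (a, b))) →
        polyVal planePoly q (.inl (u, v)) ≤ polyVal planePoly m (.inl (u, v)) := by
  let M : Set (V × Fin 2 → ℝ) := {q | ∀ a b, G.Adj a b →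
    polyVal planePoly q (.inl (a, b)) = polyVal planePoly p (.inl (a, b))}
  have hbd : ∀ w, ∃ C : ℝ, ∀ q ∈ M, ∀ i, |q (w, i) - q (u, i)| ≤ C := by
    intro w
    induction (SimpleGraph.reachable_iff_reflTransGen _ _).1 (hu w) with
    | refl => exact ⟨0, by simp⟩
    | @tail a b _ hab ih =>
      obtain ⟨C, hC⟩ := ih
      refine ⟨C + √(polyVal planePoly p (.inl (a, b))), fun q hq i => ?_⟩
      have h1 : |q (b, i) - q (a, i)| ≤ √(polyVal planePoly p (.inl (a, b))) := by
        refine Real.abs_le_sqrt ?_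
        rw [← hq a b hab, polyVal_inl]
        fin_cases i
        · change (q (b, 0) - q (a, 0)) ^ 2 ≤
            (q (a, 0) - q (b, 0)) ^ 2 + (q (a, 1) - q (b, 1)) ^ 2
          nlinarith [sq_nonneg (q (a, 1) - q (b, 1))]
        · change (q (b, 1) - q (a, 1)) ^ 2 ≤
            (q (a, 0) - q (b, 0)) ^ 2 + (q (a, 1) - q (b, 1)) ^ 2
          nlinarith [sq_nonneg (q (a, 0) - q (b, 0))]
      have h2 := abs_sub_le (q (b, i)) (q (a, i)) (q (u, i))
      linarith [hC q hq i]
  choose C hC using hbd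
  let S : Set (V × Fin 2 → ℝ) := M ∩ {q | ∀ i, q (u, i) = p (u, i)}
  have hScl : IsClosed S := by
    refine IsClosed.inter ?_ ?_
    · simp only [M, Set.ofPred_forall]
      exact isClosed_iInter fun a => isClosed_iInter fun b => isClosed_iInter fun _ =>
        isClosed_eq (continuous_polyVal _) continuous_const
    · simp only [Set.ofPred_forall]
      exact isClosed_iInter fun i => isClosed_eq (continuous_apply _) continuous_const
  have hScomp : IsCompact S := by
    refine (isCompact_univ_pi fun ci : V × Fin 2 => isCompact_Icc
      (a := p (u, ci.2) - C ci.1) (b := p (u, ci.2) + C ci.1)).of_isClosed_subset hScl ?_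
    rintro q ⟨hq, hqu⟩ ⟨w, i⟩ -
    have := abs_le.1 (hC w q hq i)
    rw [hqu i] at this
    exact ⟨by linarith [this.1], by linarith [this.2]⟩
  obtain ⟨m, hmS, hm⟩ := hScomp.exists_isMaxOn ⟨p, fun _ _ _ => rfl, fun _ => rfl⟩
    (continuous_polyVal (P := planePoly) (.inl (u, v))).continuousOn
  refine ⟨m, hmS.1, fun q hq => ?_⟩
  let q' : V × Fin 2 → ℝ := fun ci => q ci + (p (u, ci.2) - q (u, ci.2))
  have hqq : ∀ a b, polyVal planePoly q' (.inl (a, b)) = polyVal planePoly q (.inl (a, b)) := by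
    intro a b
    simp only [polyVal_inl, q']
    ring
  rw [← hqq]
  exact hm ⟨fun a b hab => (hqq a b).trans (hq a b hab), fun i => by simp [q']⟩

theorem rigidFramework_of_jacRow_mem_span [Fintype V] {G : SimpleGraph V} {p : V × Fin 2 → ℝ}
    (hp : AlgebraicIndependent ℚ p) {H : Set ((V × V) ⊕ (V × Fin 2))}
    (hHG : ∀ k ∈ H, ∃ a b, G.Adj a b ∧ k = .inl (a, b))
    (hH : LinearIndepOn ℝ (jacRow planePoly p) H)
    (hspan : ∀ a b, jacRow planePoly p (.inl (a, b)) ∈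
      Submodule.span ℝ (jacRow planePoly p '' H)) :
    RigidFramework G fun v i => p (v, i) := by
  have hev : ∀ᶠ q : V × Fin 2 → ℝ in nhds p, ∀ ab : V × V,
      (∀ j ∈ H, polyVal planePoly q j = polyVal planePoly p j) →
        polyVal planePoly q (.inl ab) = polyVal planePoly p (.inl ab) := by
    rw [Filter.eventually_all]
    rintro ⟨a, b⟩
    have hfin := finite_polyVal hp hH (hspan a b) (algebraicIndepOn_polyVal hp hH)
    have hopen := (hfin.subset (Set.sdiff_subset
      (t := {polyVal planePoly p (.inl (a, b))}))).isClosed.isOpen_compl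
    filter_upwards [(continuous_polyVal (P := planePoly) (.inl (a, b))).continuousAt
      (hopen.mem_nhds (by simp))] with q hq hqH
    by_contra hne
    exact hq ⟨⟨q, hqH, rfl⟩, hne⟩
  obtain ⟨ε, hε, hball⟩ := Metric.eventually_nhds_iff.1 hev
  refine ⟨ε, hε, fun q hq hqε a b => ?_⟩
  let q' : V × Fin 2 → ℝ := fun ci => q ci.1 ci.2
  refine eDist_eq_iff (p := p) (q := q') |>.2 (hball ((dist_pi_lt_iff hε).2 ?_) (a, b) ?_).symm
  · rintro ⟨w, i⟩
    refine lt_of_le_of_lt ?_ (hqε w)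
    rw [dist_comm, Real.dist_eq]
    exact Real.abs_le_sqrt (Finset.single_le_sum
      (f := fun i => (p (w, i) - q w i) ^ 2) (fun _ _ => sq_nonneg _) (Finset.mem_univ i))
  · intro j hj
    obtain ⟨c, d, hcd, rfl⟩ := hHG j hj
    exact (eDist_eq_iff.1 (hq c d hcd)).symm

theorem finrank_span_image {K M : Type*} [AddCommGroup M] [Module ℝ M] [Finite K] {r : K → M}
    {S : Set K} (h : LinearIndepOn ℝ r S) :
    Module.finrank ℝ (Submodule.span ℝ (r '' S)) = S.ncard := by
  have := Fintype.ofFinite S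
  rw [Set.image_eq_range, finrank_span_eq_card h, Set.ncard_eq_toFinset_card', Set.toFinset_card]

theorem linearIndepOn_jacRow_of_polyVal_eq {ι K : Type*} [Fintype ι] {P : K → MvPolynomial ι ℚ}
    {p m : ι → ℝ} (hp : AlgebraicIndependent ℚ p) {H : Set K}
    (hH : LinearIndepOn ℝ (jacRow P p) H) (hval : ∀ j ∈ H, polyVal P m j = polyVal P p j) :
    LinearIndepOn ℝ (jacRow P m) H := by
  refine linearIndepOn_jacRow ?_
  have h : (fun j : H => polyVal P m j) = fun j : H => polyVal P p j :=
    funext fun j => hval j j.2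
  rw [AlgebraicIndepOn, h]
  exact algebraicIndepOn_polyVal hp hH

theorem polyVal_ne_zero_of_area_ne_zero {x : V × Fin 2 → ℝ} {u v c : V}
    (h : area x u v c ≠ 0) : polyVal planePoly x (.inl (u, v)) ≠ 0 := by
  intro h0
  rw [polyVal_inl] at h0
  have h1 : x (u, 0) - x (v, 0) = 0 := by nlinarith [sq_nonneg (x (u, 1) - x (v, 1))]
  have h2 : x (u, 1) - x (v, 1) = 0 := by nlinarith [sq_nonneg (x (u, 0) - x (v, 0))]
  refine h ?_
  rw [area]
  linear_combination -(x (c, 1) - x (u, 1)) * h1 + (x (c, 0) - x (u, 0)) * h2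

theorem polyVal_nonneg (x : V × Fin 2 → ℝ) (u v : V) : 0 ≤ polyVal planePoly x (.inl (u, v)) := by
  rw [polyVal_inl]
  positivity

/-- The rank of the complete framework at `m` exceeds the number of edges in `H`, provided that
`H` together with the edge `uv` has full rank at a placement in general position. -/
theorem exists_jacRow_notMem_span [Fintype V] (hV : 4 ≤ Fintype.card V) {p m : V × Fin 2 → ℝ}
    {u v c : V} (hpuv : area p u v c ≠ 0) (hm : polyVal planePoly m (.inl (u, v)) ≠ 0)
    {H : Set ((V × V) ⊕ (V × Fin 2))} (hHpair : H ⊆ Set.range .inl)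
    (hH : LinearIndepOn ℝ (jacRow planePoly m) H)
    (hcard : H.ncard + 1 = Module.finrank ℝ (rowSpace p)) :
    ∃ z : V × V, jacRow planePoly m (.inl z) ∉ Submodule.span ℝ (jacRow planePoly m '' H) := by
  by_contra! hall
  have h1 : Module.finrank ℝ (rowSpace m) ≤ H.ncard := by
    rw [← finrank_span_image hH]
    refine Submodule.finrank_mono (Submodule.span_le.2 ?_)
    rintro _ ⟨z, rfl⟩
    exact hall z
  have h2 : H.ncard ≤ Module.finrank ℝ (rowSpace m) := by
    rw [← finrank_span_image hH]
    refine Submodule.finrank_mono (Submodule.span_mono ?_)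
    rintro _ ⟨k, hk, rfl⟩
    obtain ⟨z, rfl⟩ := hHpair hk
    exact ⟨z, rfl⟩
  have h3 := two_mul_card_le_of_area_ne_zero hpuv
  have h4 := finrank_rowSpace_add_three_le hpuv
  by_cases hc : ∃ c, area m u v c ≠ 0
  · obtain ⟨c, hc⟩ := hc
    have := two_mul_card_le_of_area_ne_zero hc
    omega
  · push Not at hc
    have := finrank_rowSpace_lt_of_area_eq_zero hm hc
    omega

theorem jacRow_mem_span_deleteEdges [Fintype V] {G : SimpleGraph V} (hV : 4 ≤ Fintype.card V)
    (hG : ∀ p, AlgebraicIndependent ℚ p → ∀ q, (∀ a b, G.Adj a b →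
      polyVal planePoly q (.inl (a, b)) = polyVal planePoly p (.inl (a, b))) →
      ∀ a b, polyVal planePoly q (.inl (a, b)) = polyVal planePoly p (.inl (a, b)))
    {u v : V} (huv : G.Adj u v) {p : V × Fin 2 → ℝ} (hp : AlgebraicIndependent ℚ p)
    {H : Set ((V × V) ⊕ (V × Fin 2))}
    (hHG : ∀ k ∈ H, ∃ a b, (G.deleteEdges {s(u, v)}).Adj a b ∧ k = .inl (a, b))
    (hH : LinearIndepOn ℝ (jacRow planePoly p) H)
    (hmaxH : ∀ a b, (G.deleteEdges {s(u, v)}).Adj a b →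
      jacRow planePoly p (.inl (a, b)) ∈ Submodule.span ℝ (jacRow planePoly p '' H)) (a b : V) :
    jacRow planePoly p (.inl (a, b)) ∈ Submodule.span ℝ (jacRow planePoly p '' H) := by
  classical
  by_contra hab
  set r := jacRow planePoly p with hr
  set e : (V × V) ⊕ (V × Fin 2) := .inl (u, v) with he
  have hadj : ∀ a b, G.Adj a b → (G.deleteEdges {s(u, v)}).Adj a b ∨
      (a = u ∧ b = v) ∨ (a = v ∧ b = u) := by
    intro a b hab
    rw [SimpleGraph.deleteEdges_adj, Set.mem_singleton_iff, ← Sym2.eq_iff]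
    tauto
  have hspan : ∀ z : V × V, r (.inl z) ∈ Submodule.span ℝ (r '' insert e H) := by
    intro z
    have h1 := jacRow_mem_span_of_forall span_jacRow_planePoly hp
      (E := {k | ∃ a b, G.Adj a b ∧ k = .inl (a, b)}) (k := .inl z)
      fun q hq => hG p hp q (fun a b hab => hq _ ⟨a, b, hab, rfl⟩) z.1 z.2
    refine Submodule.span_le.2 ?_ h1
    rintro _ ⟨_, ⟨a, b, hab, rfl⟩, rfl⟩
    rcases hadj a b hab with h | ⟨rfl, rfl⟩ | ⟨rfl, rfl⟩
    · exact Submodule.span_mono (Set.image_mono (Set.subset_insert _ _)) (hmaxH a b h)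
    · exact Submodule.subset_span ⟨e, Set.mem_insert _ _, rfl⟩
    · exact Submodule.subset_span ⟨e, Set.mem_insert _ _, jacRow_swap _ _ _⟩
  have heH : r e ∉ Submodule.span ℝ (r '' H) := by
    intro heH
    have h1 := hspan (a, b)
    rw [Set.image_insert_eq, Submodule.span_insert_eq_span heH] at h1
    exact hab h1
  have heH' : e ∉ H := fun h => heH (Submodule.subset_span ⟨e, h, rfl⟩)
  have hHpair : H ⊆ Set.range .inl := fun k hk => by
    obtain ⟨a, b, -, rfl⟩ := hHG k hk
    exact ⟨_, rfl⟩
  have hle : ∀ z : V × V, Submodule.span ℝ (r '' insert (.inl z) H) ≤ rowSpace p := by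
    intro z
    refine Submodule.span_mono ?_
    rintro _ ⟨k, hk, rfl⟩
    obtain ⟨y, rfl⟩ : k ∈ Set.range Sum.inl := by
      rcases hk with rfl | hk
      exacts [⟨z, rfl⟩, hHpair hk]
    exact ⟨y, rfl⟩
  have hrow : Submodule.span ℝ (r '' insert e H) = rowSpace p := by
    refine le_antisymm (hle (u, v)) (Submodule.span_le.2 ?_)
    rintro _ ⟨z, rfl⟩
    exact hspan z
  have hcard : H.ncard + 1 = Module.finrank ℝ (rowSpace p) := by
    rw [← hrow, finrank_span_image ((linearIndepOn_insert heH').2 ⟨hH, heH⟩),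
      Set.ncard_insert_of_notMem heH']
  obtain ⟨m, hmE, hmax⟩ :=
    exists_isMax (reachable_deleteEdges (by omega) hp (hG p hp) huv) p v
  have hmH : ∀ j ∈ H, polyVal planePoly m j = polyVal planePoly p j := fun j hj => by
    obtain ⟨a, b, hab, rfl⟩ := hHG j hj
    exact hmE a b hab
  obtain ⟨c, hc⟩ : ∃ c, c ∉ ({u, v} : Finset V) := by
    by_contra! h
    have := Finset.card_le_card fun x (_ : x ∈ Finset.univ) => h x
    have := Finset.card_le_two (a := u) (b := v)
    rw [Finset.card_univ] at *
    omega
  rw [Finset.mem_insert, Finset.mem_singleton, not_or] at hc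
  have harea := area_ne_zero_of_algebraicIndependent hp huv.ne (Ne.symm hc.1) (Ne.symm hc.2)
  have hmuv : polyVal planePoly m (.inl (u, v)) ≠ 0 := by
    have h1 := hmax p fun _ _ _ => rfl
    have h2 := (polyVal_nonneg p u v).lt_of_ne' (polyVal_ne_zero_of_area_ne_zero harea)
    exact (h2.trans_le h1).ne'
  have hHm := linearIndepOn_jacRow_of_polyVal_eq hp hH hmH
  obtain ⟨z, hz⟩ := exists_jacRow_notMem_span hV harea hmuv hHpair hHm hcard
  have hzH : Sum.inl z ∉ H := fun h => hz (Submodule.subset_span ⟨_, h, rfl⟩)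
  have hzm := (linearIndepOn_insert hzH).2 ⟨hHm, hz⟩
  have hzp := (linearIndepOn_insert hzH).2
    ⟨hH, jacRow_notMem_span span_jacRow_planePoly hp hH hzH hzm hmH⟩
  have hrow' : Submodule.span ℝ (r '' insert (.inl z) H) = rowSpace p := by
    refine Submodule.eq_of_le_of_finrank_eq (hle z) ?_
    rw [finrank_span_image hzp, Set.ncard_insert_of_notMem hzH, hcard]
  refine false_of_isMax span_jacRow_planePoly hp hzH (e := e)
    (E := {k | ∃ a b, (G.deleteEdges {s(u, v)}).Adj a b ∧ k = .inl (a, b)})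
    hHG hzp hzm ?_ ?_ ?_ ?_ ?_
  · rintro _ ⟨a, b, hab, rfl⟩
    exact hmaxH a b hab
  · rw [← hr, hrow']
    exact Submodule.subset_span ⟨(u, v), rfl⟩
  · rintro _ ⟨a, b, hab, rfl⟩
    exact hmE a b hab
  · exact fun q hq => hmax q fun a b hab => hq _ ⟨a, b, hab, rfl⟩
  · intro q hq q' hq'E hq'e
    refine hG q hq q' (fun a b hab => ?_) z.1 z.2
    rcases hadj a b hab with h | ⟨rfl, rfl⟩ | ⟨rfl, rfl⟩
    · exact hq'E _ ⟨a, b, h, rfl⟩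
    · exact hq'e
    · rw [polyVal_swap, hq'e, polyVal_swap]

end Plane

/-- If every generic realization of `G` (with `|V| ≥ 4`) in `ℝ²` is globally
rigid, then `G` is redundantly rigid in `ℝ²`. -/
theorem redundantly_rigid_of_globally_rigid {V : Type*} [Fintype V] [DecidableEq V]
    (G : SimpleGraph V) (hV : 4 ≤ Fintype.card V)
    (h : ∀ p : V → Fin 2 → ℝ, Generic p → GloballyRigidFramework G p) :
    ∀ e ∈ G.edgeSet, IsRigidGraph 2 (G.deleteEdges {e}) := by
  intro e he p hp
  induction e using Sym2.ind with | _ u v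
  obtain ⟨H, hHE, -, hspan, hH⟩ := exists_linearIndepOn_extension
    (linearIndepOn_empty ℝ (jacRow planePoly fun vi : V × Fin 2 => p vi.1 vi.2))
    (Set.empty_subset {k | ∃ a b, (G.deleteEdges {s(u, v)}).Adj a b ∧ k = .inl (a, b)})
  refine rigidFramework_of_jacRow_mem_span hp hHE hH
    (jacRow_mem_span_deleteEdges hV (fun x hx q hq a b => ?_) he hp hHE hH
      fun a b hab => hspan ⟨_, ⟨a, b, hab, rfl⟩, rfl⟩)
  refine (eDist_eq_iff.1 (h (fun w i => x (w, i)) hx (fun w i => q (w, i)) ?_ a b)).symm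
  exact fun a b hab => eDist_eq_iff.2 (hq a b hab).symm

end Rigidity
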